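/- Define T(a,b) = C_3(a+b−3, b) for integers a, b ≥ 0 (subtraction truncated at 0), the entries of the m = 3 n-tile tiling triangle. Then for all integers k ≥ 1 and n ≥ 2k+1, Pascal's recurrence holds: T(n,k) = T(n−1,k) + T(n−1,k−1); equivalently, C_3(n+k−3, k) = C_3(n+k−4, k) + C_3(n+k−5, k−1). -/

import Mathlib

/-- `Cm m N k` is the number of `k`-element subsets of `{1, …, N}` in which
no two elements differ by exactly `m`. -/
def Cm (m N k : ℕ) : ℕ :=
  (((Finset.Icc 1 N).powersetCard k).filter (fun S => ∀ a ∈ S, a + m ∉ S)).card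

/-- The `m = 3` `n`-tile tiling triangle. -/
def T (a b : ℕ) : ℕ := Cm 3 (a + b - 3) b

open Polynomial in
/-- The generating polynomial, by size, of the subsets of `V` in which no two elements differ
by exactly `3`. -/
noncomputable def gapPoly (V : Finset ℕ) : ℤ[X] :=
  ∑ S ∈ V.powerset, if ∀ a ∈ S, a + 3 ∉ S then X ^ S.card else 0

open Polynomial in
/-- The independence polynomial of the path on `q` vertices. -/
noncomputable def pathPoly : ℕ → ℤ[X]
  | 0 => 1
  | 1 => 1 + X
  | q + 2 => pathPoly (q + 1) + X * pathPoly q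

/-- The first `a`, `b`, `c` positive integers congruent to `1`, `2`, `0` modulo `3`. -/
def residueSet (a b c : ℕ) : Finset ℕ :=
  (Finset.Icc 1 (3 * (a + b + c))).filter fun x =>
    x % 3 = 1 ∧ x ≤ 3 * a ∨ x % 3 = 2 ∧ x ≤ 3 * b ∨ x % 3 = 0 ∧ x ≤ 3 * c

theorem mem_residueSet {a b c x : ℕ} : x ∈ residueSet a b c ↔ 1 ≤ x ∧
    (x % 3 = 1 ∧ x ≤ 3 * a ∨ x % 3 = 2 ∧ x ≤ 3 * b ∨ x % 3 = 0 ∧ x ≤ 3 * c) := by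
  simp only [residueSet, Finset.mem_filter, Finset.mem_Icc]
  omega

open Polynomial in
theorem gapPoly_insert {V V' W : Finset ℕ} {v : ℕ} (hv : v ∉ V) (hv3 : v + 3 ∉ V)
    (hW : ∀ x, x ∈ W ↔ x = v ∨ x ∈ V) (hV' : ∀ x, x ∈ V' ↔ x ∈ V ∧ x + 3 ≠ v) :
    gapPoly W = gapPoly V + X * gapPoly V' := by
  obtain rfl : W = insert v V := by ext x; simp [hW]
  unfold gapPoly
  rw [Finset.sum_powerset_insert hv, Finset.mul_sum]
  congr 1
  have hsub : V'.powerset ⊆ V.powerset :=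
    Finset.powerset_mono.2 fun x hx => ((hV' x).1 hx).1
  rw [← Finset.sum_subset hsub]
  · refine Finset.sum_congr rfl fun S hS => ?_
    have hS' := Finset.mem_powerset.1 hS
    have hvS : v ∉ S := fun h => hv ((hV' v).1 (hS' h)).1
    have hiff : (∀ a ∈ insert v S, a + 3 ∉ insert v S) ↔ ∀ a ∈ S, a + 3 ∉ S := by
      constructor
      · intro h a ha h3
        exact h a (Finset.mem_insert_of_mem ha) (Finset.mem_insert_of_mem h3)
      · intro h a ha h3
        rcases Finset.mem_insert.1 ha with rfl | ha
        · rcases Finset.mem_insert.1 h3 with h3 | h3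
          · omega
          · exact hv3 ((hV' _).1 (hS' h3)).1
        · rcases Finset.mem_insert.1 h3 with h3 | h3
          · exact ((hV' a).1 (hS' ha)).2 h3
          · exact h a ha h3
    simp only [hiff, Finset.card_insert_of_notMem hvS, pow_succ', mul_ite, mul_zero]
  · intro S hS hS'
    rw [Finset.mem_powerset] at hS hS'
    obtain ⟨x, hx, hxV'⟩ := Finset.not_subset.1 hS'
    have hxv : x + 3 = v := by
      by_contra hne
      exact hxV' ((hV' x).2 ⟨hS hx, hne⟩)
    refine if_neg fun h => h x (Finset.mem_insert_of_mem hx) ?_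
    rw [hxv]
    exact Finset.mem_insert_self _ _

open Polynomial in
theorem eq_pathPoly_mul {h : ℕ → ℤ[X]} (h1 : h 1 = h 0 + X * h 0)
    (h2 : ∀ q, h (q + 2) = h (q + 1) + X * h q) (q : ℕ) : h q = pathPoly q * h 0 := by
  induction q using Nat.twoStepInduction with
  | zero => simp [pathPoly]
  | one => rw [h1, pathPoly]; ring
  | more q ih ih' => rw [h2, ih, ih', pathPoly]; ring

theorem gapPoly_residueSet (a b c : ℕ) :
    gapPoly (residueSet a b c) = pathPoly a * pathPoly b * pathPoly c := by
  rw [eq_pathPoly_mul (h := fun a => gapPoly (residueSet a b c)),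
    eq_pathPoly_mul (h := fun b => gapPoly (residueSet 0 b c)),
    eq_pathPoly_mul (h := fun c => gapPoly (residueSet 0 0 c))]
  · have h0 : gapPoly (residueSet 0 0 0) = 1 := by simp [residueSet, gapPoly]
    rw [h0]; ring
  · apply gapPoly_insert (v := 3) <;> intros <;> simp only [mem_residueSet] <;> omega
  · intro q
    apply gapPoly_insert (v := 3 * q + 6) <;> intros <;> simp only [mem_residueSet] <;> omega
  · apply gapPoly_insert (v := 2) <;> intros <;> simp only [mem_residueSet] <;> omega
  · intro q
    apply gapPoly_insert (v := 3 * q + 5) <;> intros <;> simp only [mem_residueSet] <;> omega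
  · apply gapPoly_insert (v := 1) <;> intros <;> simp only [mem_residueSet] <;> omega
  · intro q
    apply gapPoly_insert (v := 3 * q + 4) <;> intros <;> simp only [mem_residueSet] <;> omega

theorem coeff_gapPoly_Icc (N k : ℕ) : (gapPoly (Finset.Icc 1 N)).coeff k = Cm 3 N k := by
  unfold gapPoly Cm
  rw [Polynomial.finsetSum_coeff, Finset.powersetCard_eq_filter, Finset.filter_filter,
    Finset.card_filter]
  push_cast
  refine Finset.sum_congr rfl fun S _ => ?_
  by_cases h : ∀ a ∈ S, a + 3 ∉ S
  · rw [if_pos h, Polynomial.coeff_X_pow]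
    exact if_congr (by rw [and_iff_left h, eq_comm]) rfl rfl
  · rw [if_neg h, if_neg fun h' => h h'.2, Polynomial.coeff_zero]

theorem gapPoly_Icc {N a b c : ℕ} (ha : a = (N + 2) / 3) (hb : b = (N + 1) / 3) (hc : c = N / 3) :
    gapPoly (Finset.Icc 1 N) = pathPoly a * pathPoly b * pathPoly c := by
  rw [← gapPoly_residueSet]
  congr 1
  ext x
  rw [mem_residueSet, Finset.mem_Icc]
  omega

open Polynomial in
/-- A Cassini-type identity for path polynomials. -/
theorem pathPoly_cassini (q : ℕ) :
    pathPoly (q + 1) ^ 2 - pathPoly q * pathPoly (q + 1) - X * pathPoly q ^ 2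
      = X ^ 2 * (-X) ^ q := by
  induction q with
  | zero => simp only [pathPoly]; ring
  | succ q ih =>
    rw [pathPoly]
    linear_combination -X * ih

open Polynomial in
theorem gapPoly_Icc_add_two (N : ℕ) : ∃ R : ℤ[X], gapPoly (Finset.Icc 1 (N + 2)) =
    gapPoly (Finset.Icc 1 (N + 1)) + X * gapPoly (Finset.Icc 1 N) + X ^ ((N + 1) / 3 + 2) * R := by
  obtain ⟨q, rfl | rfl | rfl⟩ : ∃ q, N = 3 * q ∨ N = 3 * q + 1 ∨ N = 3 * q + 2 :=
    ⟨N / 3, by omega⟩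
  · refine ⟨(-1) ^ q * pathPoly q, ?_⟩
    rw [gapPoly_Icc (a := q + 1) (b := q + 1) (c := q) (by omega) (by omega) (by omega),
      gapPoly_Icc (a := q + 1) (b := q) (c := q) (by omega) (by omega) (by omega),
      gapPoly_Icc (a := q) (b := q) (c := q) (by omega) (by omega) (by omega),
      show (3 * q + 1) / 3 = q by omega]
    have h := pathPoly_cassini q
    rw [neg_pow] at h
    linear_combination pathPoly q * h
  · refine ⟨(-1) ^ q * pathPoly (q + 1), ?_⟩
    rw [gapPoly_Icc (a := q + 1) (b := q + 1) (c := q + 1) (by omega) (by omega) (by omega),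
      gapPoly_Icc (a := q + 1) (b := q + 1) (c := q) (by omega) (by omega) (by omega),
      gapPoly_Icc (a := q + 1) (b := q) (c := q) (by omega) (by omega) (by omega),
      show (3 * q + 1 + 1) / 3 = q by omega]
    have h := pathPoly_cassini q
    rw [neg_pow] at h
    linear_combination pathPoly (q + 1) * h
  · refine ⟨0, ?_⟩
    rw [gapPoly_Icc (a := q + 2) (b := q + 1) (c := q + 1) (by omega) (by omega) (by omega),
      gapPoly_Icc (a := q + 1) (b := q + 1) (c := q + 1) (by omega) (by omega) (by omega),
      gapPoly_Icc (a := q + 1) (b := q + 1) (c := q) (by omega) (by omega) (by omega), pathPoly]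
    ring

theorem Cm_three_add_two {N k : ℕ} (h : 3 * k ≤ N + 1) :
    Cm 3 (N + 2) (k + 1) = Cm 3 (N + 1) (k + 1) + Cm 3 N k := by
  obtain ⟨R, hR⟩ := gapPoly_Icc_add_two N
  have hc := congrArg (fun p => p.coeff (k + 1)) hR
  simp only [Polynomial.coeff_add, Polynomial.coeff_X_mul, Polynomial.coeff_X_pow_mul',
    coeff_gapPoly_Icc] at hc
  rw [if_neg (by omega), add_zero] at hc
  exact_mod_cast hc

/-- Pascal's recurrence holds in the `m = 3` `n`-tile tiling triangle for
`k ≥ 1` and `n ≥ 2k + 1`. -/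
theorem stmt_19 (n k : ℕ) (hk : 1 ≤ k) (hn : 2 * k + 1 ≤ n) :
    T n k = T (n - 1) k + T (n - 1) (k - 1) := by
  obtain ⟨k, rfl⟩ := Nat.exists_eq_add_of_le' hk
  rcases Nat.lt_or_ge (n + k) 4 with h | h
  · obtain ⟨rfl, rfl⟩ : n = 3 ∧ k = 0 := by omega
    decide
  · obtain ⟨N, hN⟩ := Nat.exists_eq_add_of_le' h
    unfold T
    rw [show n + (k + 1) - 3 = N + 2 by omega, show n - 1 + (k + 1) - 3 = N + 1 by omega,
      show n - 1 + (k + 1 - 1) - 3 = N by omega, Nat.add_sub_cancel]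
    exact Cm_three_add_two (by omega)
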